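/- For every τ ∈ ℂ with Im τ > 0 and all x, y ∈ ℂ, the Jacobi theta functions satisfy the addition formula ϑ1(x+y|τ) ϑ1(x−y|τ) ϑ4(0|τ)² = ϑ1(x|τ)² ϑ4(y|τ)² − ϑ4(x|τ)² ϑ1(y|τ)². -/

import Mathlib

open Complex

/-- The Jacobi theta function
`ϑ₁(z|τ) = −i Σ_{n∈ℤ} (−1)^n exp(πiτ(n+1/2)² + (2n+1)πiz)`. -/
noncomputable def jacobiTheta1 (z τ : ℂ) : ℂ :=
  -I * ∑' n : ℤ, (-1 : ℂ) ^ n *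
    Complex.exp ((Real.pi : ℂ) * I * τ * ((n : ℂ) + 1 / 2) ^ 2 +
      (2 * (n : ℂ) + 1) * (Real.pi : ℂ) * I * z)

/-- The Jacobi theta function `ϑ₄(z|τ) = Σ_{n∈ℤ} (−1)^n exp(πiτn² + 2πinz)`. -/
noncomputable def jacobiTheta4 (z τ : ℂ) : ℂ :=
  ∑' n : ℤ, (-1 : ℂ) ^ n *
    Complex.exp ((Real.pi : ℂ) * I * τ * (n : ℂ) ^ 2 + 2 * (Real.pi : ℂ) * I * (n : ℂ) * z)

namespace ThetaAux

lemma tsum_split (f : ℤ × ℤ → ℂ) (hf : Summable f) :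
    ∑' p, f p = (∑' p : ℤ × ℤ, f (p.1 + p.2, p.1 - p.2)) +
      ∑' p : ℤ × ℤ, f (p.1 + p.2 + 1, p.1 - p.2) := by
  let e1 : ℤ × ℤ → ℤ × ℤ := fun p => (p.1 + p.2, p.1 - p.2)
  let e2 : ℤ × ℤ → ℤ × ℤ := fun p => (p.1 + p.2 + 1, p.1 - p.2)
  have h1 : Function.Injective e1 := by
    rintro ⟨a, b⟩ ⟨c, d⟩ h
    simp only [e1, Prod.mk.injEq] at h ⊢
    omega
  have h2 : Function.Injective e2 := by
    rintro ⟨a, b⟩ ⟨c, d⟩ h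
    simp only [e2, Prod.mk.injEq] at h ⊢
    omega
  have hc : (Set.range e1)ᶜ = Set.range e2 := by
    ext ⟨m, n⟩
    simp only [Set.mem_compl_iff, Set.mem_range, e1, e2, Prod.mk.injEq, Prod.exists]
    constructor
    · intro h
      refine ⟨(m + n - 1) / 2, (m - n - 1) / 2, ?_⟩
      by_contra h'
      exact h ⟨(m + n) / 2, (m - n) / 2, by omega⟩
    · rintro ⟨a, b, h⟩ ⟨c, d, h'⟩
      omega
  rw [← hf.tsum_subtype_add_tsum_subtype_compl (Set.range e1), hc,
    tsum_range f h1, tsum_range f h2]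

noncomputable def tA (k : ℤ) (x τ : ℂ) : ℂ :=
  cexp (2 * Real.pi * I * τ * k ^ 2 + 4 * Real.pi * I * k * x)

noncomputable def tB (k : ℤ) (x τ : ℂ) : ℂ :=
  cexp (2 * Real.pi * I * τ * (k + 1 / 2) ^ 2 + 2 * Real.pi * I * (2 * k + 1) * x)

noncomputable def t1 (n : ℤ) (z τ : ℂ) : ℂ := (-1 : ℂ) ^ n *
    Complex.exp ((Real.pi : ℂ) * I * τ * ((n : ℂ) + 1 / 2) ^ 2 +
      (2 * (n : ℂ) + 1) * (Real.pi : ℂ) * I * z)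

noncomputable def t4 (n : ℤ) (z τ : ℂ) : ℂ := (-1 : ℂ) ^ n *
    Complex.exp ((Real.pi : ℂ) * I * τ * (n : ℂ) ^ 2 + 2 * (Real.pi : ℂ) * I * (n : ℂ) * z)

lemma sum_term (z τ : ℂ) (hτ : 0 < τ.im) : Summable fun n : ℤ => ‖jacobiTheta₂_term n z τ‖ :=
  ((summable_jacobiTheta₂_term_iff z τ).2 hτ).norm

lemma sA (x τ : ℂ) (hτ : 0 < τ.im) : Summable fun n : ℤ => ‖tA n x τ‖ := by
  refine (sum_term (2 * x) (2 * τ) (by simpa using hτ)).congr fun n => ?_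
  unfold tA jacobiTheta₂_term
  congr 2
  ring

lemma sB (x τ : ℂ) (hτ : 0 < τ.im) : Summable fun n : ℤ => ‖tB n x τ‖ := by
  refine ((sum_term (2 * x + τ) (2 * τ) (by simpa using hτ)).mul_left
    ‖cexp (Real.pi * I * τ / 2 + 2 * Real.pi * I * x)‖).congr fun n => ?_
  unfold tB jacobiTheta₂_term
  rw [← norm_mul, ← Complex.exp_add]
  congr 2
  ring

lemma s4 (x τ : ℂ) (hτ : 0 < τ.im) : Summable fun n : ℤ => ‖t4 n x τ‖ := by
  refine (sum_term x τ hτ).congr fun n => ?_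
  unfold t4 jacobiTheta₂_term
  rw [norm_mul, norm_zpow, norm_neg, norm_one, one_zpow, one_mul]
  congr 2
  ring

lemma s1 (x τ : ℂ) (hτ : 0 < τ.im) : Summable fun n : ℤ => ‖t1 n x τ‖ := by
  refine ((sum_term (x + τ / 2) τ hτ).mul_left
    ‖cexp (Real.pi * I * τ / 4 + Real.pi * I * x)‖).congr fun n => ?_
  unfold t1 jacobiTheta₂_term
  rw [norm_mul ((-1 : ℂ) ^ n), norm_zpow, norm_neg, norm_one, one_zpow, one_mul,
    ← norm_mul, ← Complex.exp_add]
  congr 2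
  ring

lemma sgn_even (k l : ℤ) : (-1 : ℂ) ^ (k + l) * (-1 : ℂ) ^ (k - l) = 1 := by
  rw [← zpow_add₀ (by norm_num)]
  exact Even.neg_one_zpow ⟨k, by ring⟩

lemma sgn_odd (k l : ℤ) : (-1 : ℂ) ^ (k + l + 1) * (-1 : ℂ) ^ (k - l) = -1 := by
  rw [← zpow_add₀ (by norm_num)]
  exact Odd.neg_one_zpow ⟨k, by ring⟩

lemma prod4 (x y τ : ℂ) (hτ : 0 < τ.im) :
    jacobiTheta4 (x + y) τ * jacobiTheta4 (x - y) τ =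
      (∑' k, tA k x τ) * (∑' k, tA k y τ) - (∑' k, tB k x τ) * (∑' k, tB k y τ) := by
  change (∑' n, t4 n (x + y) τ) * (∑' n, t4 n (x - y) τ) = _
  rw [tsum_mul_tsum_of_summable_norm (s4 _ _ hτ) (s4 _ _ hτ),
    tsum_mul_tsum_of_summable_norm (sA _ _ hτ) (sA _ _ hτ),
    tsum_mul_tsum_of_summable_norm (sB _ _ hτ) (sB _ _ hτ),
    tsum_split _ (summable_mul_of_summable_norm (s4 _ _ hτ) (s4 _ _ hτ)),
    sub_eq_add_neg (∑' p : ℤ × ℤ, tA p.1 x τ * tA p.2 y τ), ← tsum_neg]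
  congr 1
  · refine tsum_congr fun ⟨k, l⟩ => ?_
    simp only [t4, tA]
    rw [mul_mul_mul_comm, sgn_even, one_mul, ← Complex.exp_add, ← Complex.exp_add]
    congr 1
    push_cast
    ring
  · refine tsum_congr fun ⟨k, l⟩ => ?_
    simp only [t4, tB]
    rw [mul_mul_mul_comm, sgn_odd, neg_one_mul, ← Complex.exp_add, ← Complex.exp_add]
    congr 2
    push_cast
    ring

lemma prod1 (x y τ : ℂ) (hτ : 0 < τ.im) :
    jacobiTheta1 (x + y) τ * jacobiTheta1 (x - y) τ =
      (∑' k, tA k x τ) * (∑' k, tB k y τ) - (∑' k, tB k x τ) * (∑' k, tA k y τ) := by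
  change (-I * ∑' n, t1 n (x + y) τ) * (-I * ∑' n, t1 n (x - y) τ) = _
  have hs : (∑' k, tA k x τ) = ∑' k, tA (k + 1) x τ :=
    ((Equiv.addRight (1 : ℤ)).tsum_eq (fun k => tA k x τ)).symm
  have hS : Summable fun k : ℤ => ‖tA (k + 1) x τ‖ :=
    (Equiv.addRight (1 : ℤ)).summable_iff.2 (sA x τ hτ)
  have key : (∑' n, t1 n (x + y) τ) * (∑' n, t1 n (x - y) τ) =
      (∑' k, tB k x τ) * (∑' k, tA k y τ) + -((∑' k, tA k x τ) * (∑' k, tB k y τ)) := by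
    rw [hs, tsum_mul_tsum_of_summable_norm (s1 _ _ hτ) (s1 _ _ hτ),
      tsum_mul_tsum_of_summable_norm hS (sB _ _ hτ),
      tsum_mul_tsum_of_summable_norm (sB _ _ hτ) (sA _ _ hτ),
      tsum_split _ (summable_mul_of_summable_norm (s1 _ _ hτ) (s1 _ _ hτ)), ← tsum_neg]
    congr 1
    · refine tsum_congr fun ⟨k, l⟩ => ?_
      simp only [t1, tA, tB]
      rw [mul_mul_mul_comm, sgn_even, one_mul, ← Complex.exp_add, ← Complex.exp_add]
      congr 1
      push_cast
      ring
    · refine tsum_congr fun ⟨k, l⟩ => ?_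
      simp only [t1, tA, tB]
      rw [mul_mul_mul_comm, sgn_odd, neg_one_mul, ← Complex.exp_add, ← Complex.exp_add]
      congr 2
      push_cast
      ring
  rw [mul_mul_mul_comm, key, neg_mul_neg, I_mul_I]
  ring

end ThetaAux

/-- **Addition formula for Jacobi theta functions:** for `Im τ > 0` and all `x, y ∈ ℂ`,
`ϑ₁(x+y|τ) ϑ₁(x−y|τ) ϑ₄(0|τ)² = ϑ₁(x|τ)² ϑ₄(y|τ)² − ϑ₄(x|τ)² ϑ₁(y|τ)²`. -/
theorem jacobiTheta1_add_mul_sub (τ : ℂ) (hτ : 0 < τ.im) (x y : ℂ) :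
    jacobiTheta1 (x + y) τ * jacobiTheta1 (x - y) τ * jacobiTheta4 0 τ ^ 2 =
      jacobiTheta1 x τ ^ 2 * jacobiTheta4 y τ ^ 2 -
        jacobiTheta4 x τ ^ 2 * jacobiTheta1 y τ ^ 2 := by
  have h := ThetaAux.prod1 x y τ hτ
  have h1 := fun z => ThetaAux.prod1 z 0 τ hτ
  have h4 := fun z => ThetaAux.prod4 z 0 τ hτ
  simp only [add_zero, sub_zero, ← sq] at h1 h4
  rw [h, h1, h1, h4, h4, h4]
  ring
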